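/- Let Z be a finite nonempty type, let p and q be probability mass functions on Z with q(z) > 0 for all z and with p absolutely continuous with respect to q, let g : Z → ℝ, and define the tilted probability mass function r(z) = q(z)·exp(g(z)) / Σ_{z'} q(z')·exp(g(z')). Then for every function R : Z → ℝ with 0 ≤ R(z) ≤ 1 for all z, |Σ_z p(z)R(z) − Σ_z r(z)R(z)| ≤ √( (1/2)·( Σ_z p(z)·log(p(z)/q(z)) + log(Σ_z q(z)·exp(g(z))) − Σ_z p(z)·g(z) ) ). -/

import Mathlib

open Real Finset

/-- **Gibbs variational inequality** on a finite type. -/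
theorem sum_mul_le_sum_mul_log_div_add_log_sum_exp {Z : Type*} [Fintype Z] [Nonempty Z]
    {p q : Z → ℝ} (hp0 : ∀ z, 0 ≤ p z) (hp1 : ∑ z, p z = 1) (hq0 : ∀ z, 0 < q z) (h : Z → ℝ) :
    ∑ z, p z * h z ≤
      (∑ z, p z * Real.log (p z / q z)) + Real.log (∑ z, q z * Real.exp (h z)) := by
  set S := ∑ z, q z * Real.exp (h z) with hS
  have hS0 : 0 < S := Finset.sum_pos (fun z _ => mul_pos (hq0 z) (Real.exp_pos _)) univ_nonempty
  have key : ∀ z, p z - q z * Real.exp (h z) / S ≤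
      p z * Real.log (p z / q z) + p z * Real.log S - p z * h z := by
    intro z
    have hw : 0 < q z * Real.exp (h z) := mul_pos (hq0 z) (Real.exp_pos _)
    rcases (hp0 z).eq_or_lt with hz | hz
    · simp only [← hz, zero_mul, zero_sub, add_zero, sub_zero, neg_nonpos]
      positivity
    · have hlog := Real.log_le_sub_one_of_pos (div_pos hw (mul_pos hS0 hz))
      rw [Real.log_div hw.ne' (mul_pos hS0 hz).ne', Real.log_mul (hq0 z).ne' (Real.exp_pos _).ne',
        Real.log_mul hS0.ne' hz.ne', Real.log_exp] at hlog
      have hmul := mul_le_mul_of_nonneg_left hlog hz.le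
      rw [Real.log_div hz.ne' (hq0 z).ne']
      have hcancel : p z * (q z * Real.exp (h z) / (S * p z) - 1) =
          q z * Real.exp (h z) / S - p z := by
        field_simp
      linarith
  have hsum := Finset.sum_le_sum fun z (_ : z ∈ univ) => key z
  rw [sum_sub_distrib, sum_sub_distrib, sum_add_distrib, ← sum_mul, ← sum_div, ← hS,
    div_self hS0.ne', hp1] at hsum
  linarith

/-- **Hoeffding's lemma** for a probability vector on a finite type. -/
theorem sum_mul_exp_le_exp_of_mem_Icc {Z : Type*} [Fintype Z] {r : Z → ℝ}
    (hr0 : ∀ z, 0 ≤ r z) (hr1 : ∑ z, r z = 1) {R : Z → ℝ} (hR : ∀ z, R z ∈ Set.Icc 0 1) (t : ℝ) :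
    ∑ z, r z * Real.exp (t * R z) ≤ Real.exp (t * (∑ z, r z * R z) + t ^ 2 / 8) := by
  let _ : MeasurableSpace Z := ⊤
  let P : PMF Z := PMF.ofFintype (fun z => ENNReal.ofReal (r z)) (by
    rw [← ENNReal.ofReal_sum_of_nonneg fun z _ => hr0 z, hr1, ENNReal.ofReal_one])
  have hint : ∀ f : Z → ℝ, ∫ z, f z ∂P.toMeasure = ∑ z, r z * f z := by
    intro f
    rw [PMF.integral_eq_sum]
    simp [P, ENNReal.toReal_ofReal (hr0 _)]
  have hsub := (ProbabilityTheory.hasSubgaussianMGF_of_mem_Icc (μ := P.toMeasure) (X := R)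
    measurable_from_top.aemeasurable (.of_forall hR)).mgf_le t
  rw [ProbabilityTheory.mgf, hint, hint] at hsub
  set m := ∑ z, r z * R z
  calc ∑ z, r z * Real.exp (t * R z)
      = Real.exp (t * m) * ∑ z, r z * Real.exp (t * (R z - m)) := by
        rw [mul_sum]
        refine sum_congr rfl fun z _ => ?_
        rw [mul_left_comm, ← Real.exp_add]
        ring_nf
    _ ≤ Real.exp (t * m) * Real.exp (t ^ 2 / 8) := by
        refine mul_le_mul_of_nonneg_left (hsub.trans_eq ?_) (Real.exp_pos _).le
        norm_num
        ring
    _ = Real.exp (t * m + t ^ 2 / 8) := (Real.exp_add _ _).symm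

/-- Core inequality of the performance-difference analysis: for pmfs `p ≪ q` on a finite
type with `q > 0`, the exponentially tilted pmf `r z = q z · exp (g z) / Σ q · exp g`, and
any reward `R` with values in `[0,1]`,
`|Σ p·R − Σ r·R| ≤ √((1/2)·(D(p‖q) + log Σ q·exp g − Σ p·g))`. -/
theorem perf_diff_core {Z : Type*} [Fintype Z] [Nonempty Z]
    (p q : Z → ℝ)
    (hp0 : ∀ z, 0 ≤ p z) (hp1 : ∑ z, p z = 1)
    (hq0 : ∀ z, 0 < q z) (hq1 : ∑ z, q z = 1)
    (hac : ∀ z, q z = 0 → p z = 0)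
    (g : Z → ℝ)
    (r : Z → ℝ)
    (hr : ∀ z, r z = q z * Real.exp (g z) / ∑ z', q z' * Real.exp (g z'))
    (R : Z → ℝ) (hR0 : ∀ z, 0 ≤ R z) (hR1 : ∀ z, R z ≤ 1) :
    |(∑ z, p z * R z) - ∑ z, r z * R z| ≤
      Real.sqrt ((1 / 2) * ((∑ z, p z * Real.log (p z / q z))
        + Real.log (∑ z, q z * Real.exp (g z)) - ∑ z, p z * g z)) := by
  set S := ∑ z, q z * Real.exp (g z) with hS
  have hS0 : 0 < S := Finset.sum_pos (fun z _ => mul_pos (hq0 z) (Real.exp_pos _)) univ_nonempty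
  have hr0 : ∀ z, 0 ≤ r z := fun z => by
    rw [hr]
    exact div_nonneg (mul_pos (hq0 z) (Real.exp_pos _)).le hS0.le
  have hr1 : ∑ z, r z = 1 := by
    simp_rw [hr]
    rw [← sum_div, ← hS, div_self hS0.ne']
  set δ := (∑ z, p z * R z) - ∑ z, r z * R z with hδ
  have htilt : ∑ z, q z * Real.exp (g z + 4 * δ * R z) =
      S * ∑ z, r z * Real.exp (4 * δ * R z) := by
    rw [mul_sum]
    refine sum_congr rfl fun z _ => ?_
    rw [hr, Real.exp_add]
    field_simp
  have hpos : 0 < ∑ z, q z * Real.exp (g z + 4 * δ * R z) :=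
    Finset.sum_pos (fun z _ => mul_pos (hq0 z) (Real.exp_pos _)) univ_nonempty
  have hlog : Real.log (∑ z, q z * Real.exp (g z + 4 * δ * R z)) ≤
      Real.log S + (4 * δ * (∑ z, r z * R z) + (4 * δ) ^ 2 / 8) := by
    rw [← Real.log_exp (4 * δ * (∑ z, r z * R z) + (4 * δ) ^ 2 / 8),
      ← Real.log_mul hS0.ne' (Real.exp_pos _).ne']
    refine Real.log_le_log hpos (htilt.trans_le ?_)
    exact mul_le_mul_of_nonneg_left
      (sum_mul_exp_le_exp_of_mem_Icc hr0 hr1 (fun z => ⟨hR0 z, hR1 z⟩) _) hS0.le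
  have hgibbs := sum_mul_le_sum_mul_log_div_add_log_sum_exp hp0 hp1 hq0
    fun z => g z + 4 * δ * R z
  have hlin : ∑ z, p z * (g z + 4 * δ * R z) =
      (∑ z, p z * g z) + 4 * δ * ∑ z, p z * R z := by
    rw [mul_sum, ← sum_add_distrib]
    exact sum_congr rfl fun z _ => by ring
  have hsq : 4 * δ * (∑ z, p z * R z) - 4 * δ * (∑ z, r z * R z) = 4 * δ ^ 2 := by
    rw [← mul_sub, ← hδ]
    ring
  refine Real.abs_le_sqrt ?_
  linarith
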